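/- arXiv:1703.07073 — 3 statements merged into one kernel-verified Lean document; each statement's English description precedes it below -/
import Mathlib

section
/- Let d ∈ ℕ with d > 0. Let (ω_k)_{k∈ℕ∪{∞}} and (η_k)_{k∈ℕ∪{∞}} be families of continuous functions from ℝ to ℂ^d and let (ð_k)_{k∈ℕ} be a sequence of nonzero real numbers converging to some ð_∞ ≠ 0, such that: (i) ω_k → ω_∞ and η_k → η_∞ uniformly on every compact subset of ℝ as k → ∞; (ii) there exists M > 0 such that for all k ∈ ℕ∪{∞} and all t ∈ ℝ, max{‖ω_k(t)‖_{ℂ^d}, ‖η_k(t)‖_{ℂ^d}} ≤ M/(1 + t²). Then lim_{k→∞} Σ_{n∈ℤ∖{0}} (1/(4π²n²)) ∫_ℝ Σ_{m∈ℤ} ‖ω_k(t + ð_k m) − ω_∞(t + ð_∞ m)‖_{ℂ^d} · ‖η_k(t)‖_{ℂ^d} dt = 0. -/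
open MeasureTheory Filter Topology ENNReal

/-- The Lorentzian `1 / (1 + (c m)²)` is summable over the integers. -/
lemma summable_int_one_div_one_add_mul_sq {c : ℝ} (hc : 0 < c) :
    Summable fun m : ℤ => 1 / (1 + (c * (m : ℝ)) ^ 2) := by
  have h1 : Summable fun m : ℤ => 1 / c ^ 2 * (1 / (m : ℝ) ^ 2) :=
    (Real.summable_one_div_int_pow.mpr one_lt_two).mul_left _
  have h2 : Summable fun m : ℤ => if m = 0 then (1 : ℝ) else 0 := (hasSum_ite_eq 0 1).summable
  refine Summable.of_nonneg_of_le (fun m => by positivity) (fun m => ?_) (h1.add h2)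
  by_cases hm : m = 0
  · simp [hm]
  · have hm' : (m : ℝ) ≠ 0 := by exact_mod_cast hm
    have h3 : 0 < (c * (m : ℝ)) ^ 2 := by positivity
    rw [if_neg hm, add_zero, one_div_mul_one_div, ← mul_pow]
    exact one_div_le_one_div_of_le h3 (by linarith)

lemma tsum_int_ofReal_one_div_one_add_mul_sq_ne_top {c : ℝ} (hc : 0 < c) :
    ∑' m : ℤ, ENNReal.ofReal (1 / (1 + (c * (m : ℝ)) ^ 2)) ≠ ⊤ :=
  (summable_int_one_div_one_add_mul_sq hc).tsum_ofReal_ne_top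

/-- Sums of the Lorentzian along translates of a lattice are bounded uniformly in the translate and
in the mesh, as long as the mesh stays away from zero. -/
lemma tsum_int_translate_le {a h : ℝ} (ha : 0 < a) (hh : a ≤ |h|) (t : ℝ) :
    ∑' m : ℤ, ENNReal.ofReal (1 / (1 + (t + h * (m : ℝ)) ^ 2)) ≤
      ∑' m : ℤ, ENNReal.ofReal (1 / (1 + (a / 2 * (m : ℝ)) ^ 2)) := by
  have hh0 : h ≠ 0 := by
    rintro rfl
    simp only [abs_zero] at hh
    linarith
  rw [← (Equiv.subRight (round (t / h))).tsum_eq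
    fun m : ℤ => ENNReal.ofReal (1 / (1 + (t + h * (m : ℝ)) ^ 2))]
  refine ENNReal.tsum_le_tsum fun m => ENNReal.ofReal_le_ofReal ?_
  refine one_div_le_one_div_of_le (by positivity) ?_
  gcongr 1 + ?_
  rw [sq_le_sq]
  have hr := abs_sub_round (t / h)
  set r := t / h - round (t / h) with hrdef
  have heq : t + h * (((Equiv.subRight (round (t / h))) m : ℤ) : ℝ) = h * (r + m) := by
    simp only [Equiv.subRight_apply, Int.cast_sub, hrdef]
    field_simp
    ring
  have hm : |(m : ℝ)| / 2 ≤ |r + m| := by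
    by_cases hm0 : m = 0
    · simp [hm0]
    · have h1 : (1 : ℝ) ≤ |(m : ℝ)| := by exact_mod_cast Int.one_le_abs hm0
      have h2 : |(m : ℝ)| ≤ |r + m| + |r| := by
        have h3 := abs_sub (r + m) r
        rwa [add_sub_cancel_left] at h3
      linarith
  rw [heq, abs_mul, abs_mul, abs_of_pos (half_pos ha)]
  calc a / 2 * |(m : ℝ)| = a * (|(m : ℝ)| / 2) := by ring
    _ ≤ |h| * |r + m| := by gcongr

lemma one_div_one_add_add_mul_sq_le {a h : ℝ} (ha : 0 < a) (hh : a ≤ |h|) (t x : ℝ) :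
    1 / (1 + (t + h * x) ^ 2) ≤ 2 * (1 + t ^ 2) * (1 / (1 + (a * x) ^ 2)) := by
  have h1 : (a * x) ^ 2 ≤ (h * x) ^ 2 := by
    rw [mul_pow, mul_pow]
    have : a ^ 2 ≤ h ^ 2 := by rw [sq_le_sq, abs_of_pos ha]; exact hh
    gcongr
  rw [mul_one_div, div_le_div_iff₀ (by positivity) (by positivity)]
  nlinarith [sq_nonneg (t + (t + h * x)), mul_nonneg (sq_nonneg t) (sq_nonneg (t + h * x))]

/-- The pointwise (in `t`) part: the lattice sums converge to zero. -/
lemma tendsto_tsum_int_nnnorm_sub_mul {E : Type*} [NormedAddCommGroup E]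
    {ω η : ℕ → ℝ → E} {ωlim ηlim : ℝ → E} (hcωlim : Continuous ωlim)
    {dh : ℕ → ℝ} {dhlim : ℝ} (hdhconv : Tendsto dh atTop (𝓝 dhlim))
    (hωconv : TendstoLocallyUniformly ω ωlim atTop)
    {t : ℝ} (hηconv : Tendsto (fun j => η j t) atTop (𝓝 (ηlim t)))
    {g : ℤ → ℝ≥0∞} (hg : ∑' m, g m ≠ ⊤)
    (hbound : ∀ᶠ j in atTop, ∀ m : ℤ,
      (‖ω j (t + dh j * (m : ℝ)) - ωlim (t + dhlim * (m : ℝ))‖₊ : ℝ≥0∞) * (‖η j t‖₊ : ℝ≥0∞)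
        ≤ g m) :
    Tendsto (fun j => ∑' m : ℤ,
      (‖ω j (t + dh j * (m : ℝ)) - ωlim (t + dhlim * (m : ℝ))‖₊ : ℝ≥0∞) * (‖η j t‖₊ : ℝ≥0∞))
      atTop (𝓝 0) := by
  simp_rw [← lintegral_count] at hg ⊢
  rw [← lintegral_zero (μ := (Measure.count : Measure ℤ))]
  refine tendsto_lintegral_filter_of_dominated_convergence g
    (Eventually.of_forall fun j => Measurable.of_discrete)
    (hbound.mono fun j hj => Eventually.of_forall hj) hg (Eventually.of_forall fun m => ?_)
  have hpt : Tendsto (fun j => t + dh j * (m : ℝ)) atTop (𝓝 (t + dhlim * (m : ℝ))) :=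
    tendsto_const_nhds.add (hdhconv.mul_const _)
  have h1 := hωconv.tendsto_comp hcωlim.continuousAt hpt
  have h2 : Tendsto (fun j => ‖ω j (t + dh j * (m : ℝ)) - ωlim (t + dhlim * (m : ℝ))‖₊ * ‖η j t‖₊)
      atTop (𝓝 0) := by
    have h3 := (h1.sub_const (ωlim (t + dhlim * (m : ℝ)))).nnnorm.mul hηconv.nnnorm
    simpa using h3
  simp_rw [← ENNReal.coe_mul]
  exact ENNReal.tendsto_coe.mpr h2

theorem statement_1 (d : ℕ) (hd : 0 < d)
    (ω η : ℕ → ℝ → EuclideanSpace ℂ (Fin d)) (ωlim ηlim : ℝ → EuclideanSpace ℂ (Fin d))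
    (hcω : ∀ j, Continuous (ω j)) (hcωlim : Continuous ωlim)
    (hcη : ∀ j, Continuous (η j)) (hcηlim : Continuous ηlim)
    (dh : ℕ → ℝ) (dhlim : ℝ) (hdh : ∀ j, dh j ≠ 0) (hdhlim : dhlim ≠ 0)
    (hdhconv : Tendsto dh atTop (𝓝 dhlim))
    (hωconv : ∀ K : Set ℝ, IsCompact K → TendstoUniformlyOn (fun j t => ω j t) ωlim atTop K)
    (hηconv : ∀ K : Set ℝ, IsCompact K → TendstoUniformlyOn (fun j t => η j t) ηlim atTop K)
    (M : ℝ) (hM : 0 < M)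
    (hb : ∀ j t, max ‖ω j t‖ ‖η j t‖ ≤ M / (1 + t ^ 2))
    (hblim : ∀ t, max ‖ωlim t‖ ‖ηlim t‖ ≤ M / (1 + t ^ 2)) :
    Tendsto (fun j : ℕ => ∑' n : {n : ℤ // n ≠ 0},
        ENNReal.ofReal (1 / (4 * Real.pi ^ 2 * (n.1 : ℝ) ^ 2)) *
        ∫⁻ t : ℝ, ∑' m : ℤ,
          (‖ω j (t + dh j * (m : ℝ)) - ωlim (t + dhlim * (m : ℝ))‖₊ : ℝ≥0∞)
            * (‖η j t‖₊ : ℝ≥0∞))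
      atTop (𝓝 0) := by
  have hC : ∑' n : {n : ℤ // n ≠ 0},
      ENNReal.ofReal (1 / (4 * Real.pi ^ 2 * (n.1 : ℝ) ^ 2)) ≠ ⊤ := by
    have h1 : Summable fun n : ℤ => 1 / (4 * Real.pi ^ 2 * (n : ℝ) ^ 2) := by
      simp_rw [← one_div_mul_one_div (4 * Real.pi ^ 2)]
      exact (Real.summable_one_div_int_pow.mpr one_lt_two).mul_left _
    exact (h1.comp_injective Subtype.val_injective).tsum_ofReal_ne_top
  refine Tendsto.congr (fun j => ENNReal.tsum_mul_right.symm) ?_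
  rw [← mul_zero (∑' n : {n : ℤ // n ≠ 0},
      ENNReal.ofReal (1 / (4 * Real.pi ^ 2 * (n.1 : ℝ) ^ 2)))]
  refine ENNReal.Tendsto.const_mul ?_ (Or.inr hC)
  obtain ⟨a, ha, hah⟩ := exists_between (abs_pos.mpr hdhlim)
  have hdha : ∀ᶠ j in atTop, a ≤ |dh j| :=
    (hdhconv.abs.eventually (lt_mem_nhds hah)).mono fun j hj => hj.le
  have hterm : ∀ (j : ℕ) (t : ℝ) (m : ℤ),
      (‖ω j (t + dh j * (m : ℝ)) - ωlim (t + dhlim * (m : ℝ))‖₊ : ℝ≥0∞) * (‖η j t‖₊ : ℝ≥0∞) ≤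
        (ENNReal.ofReal (1 / (1 + (t + dh j * (m : ℝ)) ^ 2)) +
          ENNReal.ofReal (1 / (1 + (t + dhlim * (m : ℝ)) ^ 2))) *
          ENNReal.ofReal (M ^ 2 * (1 + t ^ 2)⁻¹) := by
    intro j t m
    rw [← ENNReal.ofReal_add (by positivity) (by positivity),
      ← ENNReal.ofReal_mul (by positivity), ← ENNReal.coe_mul, ← nnnorm_norm (ω j _ - _),
      ← nnnorm_norm (η j t), ← nnnorm_mul, ← enorm_eq_nnnorm,
      Real.enorm_of_nonneg (by positivity)]
    refine ENNReal.ofReal_le_ofReal ?_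
    calc _ ≤ (M / (1 + (t + dh j * (m : ℝ)) ^ 2) + M / (1 + (t + dhlim * (m : ℝ)) ^ 2)) *
          (M / (1 + t ^ 2)) := by
          refine mul_le_mul ((norm_sub_le _ _).trans (add_le_add ?_ ?_)) ?_ (norm_nonneg _)
            (by positivity)
          · exact (le_max_left _ _).trans (hb j _)
          · exact (le_max_left _ _).trans (hblim _)
          · exact (le_max_right _ _).trans (hb j _)
      _ = _ := by ring
  rw [← lintegral_zero (μ := (volume : Measure ℝ))]
  refine tendsto_lintegral_filter_of_dominated_convergence
    (fun t => (∑' m : ℤ, ENNReal.ofReal (1 / (1 + (a / 2 * (m : ℝ)) ^ 2)) +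
      ∑' m : ℤ, ENNReal.ofReal (1 / (1 + (a / 2 * (m : ℝ)) ^ 2))) *
      ENNReal.ofReal (M ^ 2 * (1 + t ^ 2)⁻¹))
    (Eventually.of_forall fun j => ?_) (hdha.mono fun j hj => Eventually.of_forall fun t => ?_)
    ?_ (Eventually.of_forall fun t => ?_)
  · have := hcω j
    have := hcη j
    refine Measurable.tsum fun m => Continuous.measurable ?_
    simp_rw [← ENNReal.coe_mul]
    refine ENNReal.continuous_coe.comp ?_
    fun_prop
  · refine (ENNReal.tsum_le_tsum fun m => hterm j t m).trans ?_
    rw [ENNReal.tsum_mul_right, ENNReal.tsum_add]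
    gcongr ?_ * _
    exact add_le_add (tsum_int_translate_le ha hj t) (tsum_int_translate_le ha hah.le t)
  · have hS := tsum_int_ofReal_one_div_one_add_mul_sq_ne_top (half_pos ha)
    rw [lintegral_const_mul' _ _ (ENNReal.add_ne_top.mpr ⟨hS, hS⟩)]
    exact ENNReal.mul_ne_top (ENNReal.add_ne_top.mpr ⟨hS, hS⟩)
      (integrable_inv_one_add_sq.const_mul (M ^ 2)).lintegral_lt_top.ne
  · refine tendsto_tsum_int_nnnorm_sub_mul (ηlim := ηlim) hcωlim hdhconv
      (tendstoLocallyUniformly_iff_forall_isCompact.mpr hωconv)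
      ((hηconv {t} isCompact_singleton).tendsto_at (Set.mem_singleton t))
      (g := fun m => (ENNReal.ofReal (2 * (1 + t ^ 2)) + ENNReal.ofReal (2 * (1 + t ^ 2))) *
        ENNReal.ofReal (1 / (1 + (a * (m : ℝ)) ^ 2)) * ENNReal.ofReal (M ^ 2 * (1 + t ^ 2)⁻¹))
      ?_ (hdha.mono fun j hj m => (hterm j t m).trans ?_)
    · rw [ENNReal.tsum_mul_right, ENNReal.tsum_mul_left]
      exact ENNReal.mul_ne_top (ENNReal.mul_ne_top
        (ENNReal.add_ne_top.mpr ⟨ENNReal.ofReal_ne_top, ENNReal.ofReal_ne_top⟩)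
        (tsum_int_ofReal_one_div_one_add_mul_sq_ne_top ha)) ENNReal.ofReal_ne_top
    · rw [add_mul (ENNReal.ofReal (2 * (1 + t ^ 2))),
        ← ENNReal.ofReal_mul (p := 2 * (1 + t ^ 2)) (by positivity)]
      gcongr ?_ * _
      exact add_le_add (ENNReal.ofReal_le_ofReal (one_div_one_add_add_mul_sq_le ha hj t m))
        (ENNReal.ofReal_le_ofReal (one_div_one_add_add_mul_sq_le ha hah.le t m))
end

section
/- Let d ∈ ℕ with d > 0, let C > 0, M > 0, and 0 < ð₋ < ð₊. Then there exists K > 0 such that: for every Schwartz function ξ ∈ 𝒮(ℝ, ℂ^d) satisfying max{‖ξ^{(j)}(s)‖_{ℂ^d}, ‖s·ξ^{(j)}(s)‖_{ℂ^d} : j ∈ {0,1,2,3}} ≤ M/(1 + s²) for all s ∈ ℝ, for every ð ∈ [ð₋, ð₊], every s ∈ ℝ, and every (x, y, u) ∈ ℝ³ with |x| + |y| + |u| ≤ C, one has max_{j∈{0,1,2}} ‖(α_ð^{x,y,u}ξ)^{(j)}(s) − ξ^{(j)}(s)‖_{ℂ^d} ≤ K·(|x| + |y| + |u|)/(1 +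 s²). -/
open MeasureTheory Filter Topology

noncomputable section

/-- The Heisenberg group action `α_ð^{x,y,u}`:
`(α_ð^{x,y,u}ξ)(s) = exp(2iπ(ðu + sx))·ξ(s + ðy)`. -/
def alphaFun {E : Type*} [AddCommGroup E] [Module ℂ E] (dh x y u : ℝ) (ξ : ℝ → E) : ℝ → E :=
  fun s => Complex.exp (2 * (Real.pi : ℂ) * Complex.I * ((dh : ℂ) * (u : ℂ) + (s : ℂ) * (x : ℂ)))
    • ξ (s + dh * y)

theorem exp_alphaFun_eq (dh x u s : ℝ) :
    Complex.exp (2 * (Real.pi : ℂ) * Complex.I * ((dh : ℂ) * (u : ℂ) + (s : ℂ) * (x : ℂ)))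
      = Complex.exp (Complex.I * ((2 * Real.pi * (dh * u + s * x) : ℝ) : ℂ)) := by
  congr 1
  push_cast
  ring

theorem norm_alphaFun {E : Type*} [NormedAddCommGroup E] [NormedSpace ℂ E]
    (dh x y u : ℝ) (f : ℝ → E) (s : ℝ) :
    ‖alphaFun dh x y u f s‖ = ‖f (s + dh * y)‖ := by
  rw [alphaFun, exp_alphaFun_eq, norm_smul, Complex.norm_exp_I_mul_ofReal, one_mul]

theorem hasDerivAt_alphaFun {E : Type*} [NormedAddCommGroup E] [NormedSpace ℝ E] [NormedSpace ℂ E]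
    [IsScalarTower ℝ ℂ E] (dh x y u : ℝ) {f f' : ℝ → E} (hf : ∀ s, HasDerivAt f (f' s) s)
    (s : ℝ) :
    HasDerivAt (alphaFun dh x y u f)
      ((2 * (Real.pi : ℂ) * Complex.I * (x : ℂ)) • alphaFun dh x y u f s
        + alphaFun dh x y u f' s) s := by
  have h1 : HasDerivAt (fun r : ℝ => 2 * (Real.pi : ℂ) * Complex.I *
      ((dh : ℂ) * (u : ℂ) + (r : ℂ) * (x : ℂ)))
      (2 * (Real.pi : ℂ) * Complex.I * (1 * (x : ℂ))) s :=
    ((Complex.ofRealCLM.hasDerivAt.mul_const (x : ℂ)).const_add _).const_mul _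
  have h2 := h1.cexp.smul ((hf (s + dh * y)).comp_add_const s (dh * y))
  refine h2.congr_deriv ?_
  simp only [alphaFun, smul_smul, one_mul]
  rw [add_comm, mul_comm (Complex.exp _)]

theorem one_div_one_add_sq_shift_le {A a : ℝ} (ha : |a| ≤ A) (s : ℝ) :
    1 / (1 + (s + a) ^ 2) ≤ 2 * (1 + A ^ 2) / (1 + s ^ 2) := by
  rw [div_le_div_iff₀ (by positivity) (by positivity)]
  have h : a ^ 2 ≤ A ^ 2 := sq_le_sq' (abs_le.mp ha).1 (abs_le.mp ha).2
  nlinarith [sq_nonneg (s + 2 * a), sq_nonneg s, sq_nonneg (s + a),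
    mul_nonneg (sq_nonneg (s + a)) (sq_nonneg A)]

theorem norm_shift_le {E : Type*} [NormedAddCommGroup E] {M A : ℝ} (hM : 0 ≤ M) {f : ℝ → E}
    (hf : ∀ s, ‖f s‖ ≤ M / (1 + s ^ 2)) {a : ℝ} (ha : |a| ≤ A) (s : ℝ) :
    ‖f (s + a)‖ ≤ 2 * M * (1 + A ^ 2) / (1 + s ^ 2) := by
  refine (hf _).trans ?_
  have h := mul_le_mul_of_nonneg_left (one_div_one_add_sq_shift_le ha s) hM
  calc M / (1 + (s + a) ^ 2) = M * (1 / (1 + (s + a) ^ 2)) := by ring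
    _ ≤ _ := h
    _ = _ := by ring

theorem norm_shift_sub_le {E : Type*} [NormedAddCommGroup E] [NormedSpace ℝ E] {M A : ℝ}
    (hM : 0 ≤ M) {f f' : ℝ → E} (hd : ∀ s, HasDerivAt f (f' s) s)
    (hf' : ∀ s, ‖f' s‖ ≤ M / (1 + s ^ 2))
    {a : ℝ} (ha : |a| ≤ A) (s : ℝ) :
    ‖f (s + a) - f s‖ ≤ 2 * M * (1 + A ^ 2) / (1 + s ^ 2) * |a| := by
  have h := (convex_uIcc s (s + a)).norm_image_sub_le_of_norm_hasDerivWithin_le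
    (f := f) (f' := f') (C := 2 * M * (1 + A ^ 2) / (1 + s ^ 2))
    (fun r _ => (hd r).hasDerivWithinAt) (fun r hr => ?_)
    Set.left_mem_uIcc Set.right_mem_uIcc
  · simpa [Real.norm_eq_abs] using h
  · have h1 : |r - s| ≤ A := by
      refine (Set.abs_sub_left_of_mem_uIcc hr).trans ?_
      simpa using ha
    simpa using norm_shift_le hM hf' h1 s

theorem norm_alphaFun_sub_le {E : Type*} [NormedAddCommGroup E] [NormedSpace ℝ E] [NormedSpace ℂ E]
    [IsScalarTower ℝ ℂ E] {M A D : ℝ} (hM : 0 ≤ M) {f f' : ℝ → E}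
    (hd : ∀ s, HasDerivAt f (f' s) s) (hf : ∀ s, ‖f s‖ ≤ M / (1 + s ^ 2))
    (hsf : ∀ s, |s| * ‖f s‖ ≤ M / (1 + s ^ 2)) (hf' : ∀ s, ‖f' s‖ ≤ M / (1 + s ^ 2))
    {dh x y u : ℝ} (hD : |dh| ≤ D) (hA : |dh * y| ≤ A) (s : ℝ) :
    ‖alphaFun dh x y u f s - f s‖
      ≤ (2 * Real.pi * (D + 1 + A) + D) * (2 * M * (1 + A ^ 2)) * (|x| + |y| + |u|)
        / (1 + s ^ 2) := by
  have hD0 : 0 ≤ D := (abs_nonneg _).trans hD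
  have hA0 : 0 ≤ A := (abs_nonneg _).trans hA
  set B := 2 * M * (1 + A ^ 2) / (1 + s ^ 2) with hB
  have hB0 : 0 ≤ B := by positivity
  set e := Complex.exp (2 * (Real.pi : ℂ) * Complex.I *
    ((dh : ℂ) * (u : ℂ) + (s : ℂ) * (x : ℂ))) with he
  have h1 : ‖f (s + dh * y)‖ ≤ B := norm_shift_le hM hf hA s
  have h2 : |s + dh * y| * ‖f (s + dh * y)‖ ≤ B := by
    have := norm_shift_le hM (f := fun r => r • f r)
      (fun r => by simpa [norm_smul] using hsf r) hA s
    simpa [norm_smul] using this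
  have h3 : |s| * ‖f (s + dh * y)‖ ≤ (1 + A) * B := by
    have : |s| ≤ |s + dh * y| + |dh * y| := by
      simpa using abs_sub (s + dh * y) (dh * y)
    nlinarith [mul_le_mul_of_nonneg_right this (norm_nonneg (f (s + dh * y))),
      mul_le_mul hA h1 (norm_nonneg _) hA0]
  have h4 : ‖f (s + dh * y) - f s‖ ≤ B * (D * |y|) := by
    refine (norm_shift_sub_le hM hd hf' hA s).trans ?_
    rw [abs_mul]
    gcongr
  have h5 : ‖e - 1‖ ≤ 2 * Real.pi * (D * |u| + |s| * |x|) := by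
    rw [he, exp_alphaFun_eq]
    refine (Real.norm_exp_I_mul_ofReal_sub_one_le).trans ?_
    rw [Real.norm_eq_abs, abs_mul, abs_of_pos Real.two_pi_pos]
    gcongr
    refine (abs_add_le _ _).trans ?_
    rw [abs_mul, abs_mul]
    gcongr
  have h6 : alphaFun dh x y u f s - f s
      = (e - 1) • f (s + dh * y) + (f (s + dh * y) - f s) := by
    rw [alphaFun, sub_smul, one_smul]
    abel
  have h7 : ‖e - 1‖ * ‖f (s + dh * y)‖ ≤ 2 * Real.pi * (D * |u| * B + |x| * ((1 + A) * B)) := by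
    calc _ ≤ 2 * Real.pi * (D * |u| + |s| * |x|) * ‖f (s + dh * y)‖ := by gcongr
      _ = 2 * Real.pi * (D * |u| * ‖f (s + dh * y)‖ + |x| * (|s| * ‖f (s + dh * y)‖)) := by ring
      _ ≤ _ := by gcongr
  calc _ ≤ ‖e - 1‖ * ‖f (s + dh * y)‖ + ‖f (s + dh * y) - f s‖ := by
        rw [h6, ← norm_smul]
        exact norm_add_le _ _
    _ ≤ 2 * Real.pi * (D * |u| * B + |x| * ((1 + A) * B)) + B * (D * |y|) := add_le_add h7 h4
    _ ≤ 2 * Real.pi * (D * (|x| + |y| + |u|) * B + (|x| + |y| + |u|) * ((1 + A) * B))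
        + B * (D * (|x| + |y| + |u|)) := by
      have := abs_nonneg x
      have := abs_nonneg y
      have := abs_nonneg u
      gcongr <;> linarith
    _ = _ := by
      rw [hB]
      ring

theorem statement_10 (d : ℕ) (hd : 0 < d) (C M dm dp : ℝ)
    (hC : 0 < C) (hM : 0 < M) (hdm : 0 < dm) (hdmp : dm < dp) :
    ∃ K > (0 : ℝ), ∀ ξ : SchwartzMap ℝ (EuclideanSpace ℂ (Fin d)),
      (∀ (s : ℝ) (j : ℕ), j ≤ 3 →
          ‖iteratedDeriv j (⇑ξ) s‖ ≤ M / (1 + s ^ 2)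
          ∧ |s| * ‖iteratedDeriv j (⇑ξ) s‖ ≤ M / (1 + s ^ 2)) →
      ∀ dh ∈ Set.Icc dm dp, ∀ (s : ℝ) (x y u : ℝ), |x| + |y| + |u| ≤ C →
        ∀ (j : ℕ), j ≤ 2 →
          ‖iteratedDeriv j (alphaFun dh x y u ⇑ξ) s - iteratedDeriv j (⇑ξ) s‖
            ≤ K * (|x| + |y| + |u|) / (1 + s ^ 2) := by
  set A := dp * C with hAdef
  have hdp : 0 < dp := hdm.trans hdmp
  have hA0 : 0 < A := mul_pos hdp hC
  set L := (2 * Real.pi * (dp + 1 + A) + dp) * (2 * M * (1 + A ^ 2)) with hL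
  set N := 2 * M * (1 + A ^ 2) with hN
  have hN0 : 0 < N := by positivity
  have hL0 : 0 < L := by positivity
  refine ⟨L + (4 * Real.pi + 4 * Real.pi ^ 2 * C) * N, by positivity, ?_⟩
  intro ξ hξ dh hdh s x y u hxyu j hj
  have hx := abs_nonneg x
  have hy := abs_nonneg y
  have hu := abs_nonneg u
  have hD : |dh| ≤ dp := by
    rw [abs_of_nonneg (hdm.le.trans hdh.1)]
    exact hdh.2
  have hA : |dh * y| ≤ A := by
    rw [abs_mul]
    exact mul_le_mul hD (by linarith) hy hdp.le
  have hd : ∀ k r, HasDerivAt (iteratedDeriv k ξ) (iteratedDeriv (k + 1) ξ r) r := by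
    intro k r
    rw [iteratedDeriv_succ]
    exact ((ξ.smooth (k + 1)).differentiable_iteratedDeriv k (mod_cast Nat.lt_succ_self k)
      r).hasDerivAt
  set T := |x| + |y| + |u| with hT
  have hT0 : 0 ≤ T := by positivity
  have main : ∀ k ≤ 2, ‖alphaFun dh x y u (iteratedDeriv k ξ) s - iteratedDeriv k ξ s‖
      ≤ L * T / (1 + s ^ 2) := fun k hk =>
    norm_alphaFun_sub_le hM.le (hd k) (fun r => (hξ r k (by omega)).1)
      (fun r => (hξ r k (by omega)).2) (fun r => (hξ r (k + 1) (by omega)).1) hD hA s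
  have hN1 : ∀ k ≤ 2, ‖alphaFun dh x y u (iteratedDeriv k ξ) s‖ ≤ N / (1 + s ^ 2) := by
    intro k hk
    rw [norm_alphaFun]
    exact norm_shift_le hM.le (fun r => (hξ r k (by omega)).1) hA s
  set c : ℂ := 2 * (Real.pi : ℂ) * Complex.I * (x : ℂ) with hc
  have hcn : ‖c‖ ≤ 2 * Real.pi * T := by
    have : ‖c‖ = 2 * Real.pi * |x| := by
      simp [hc, abs_of_pos Real.pi_pos]
    rw [this]
    gcongr
    linarith
  have hα : ∀ k, deriv (alphaFun dh x y u (iteratedDeriv k ξ)) = fun r =>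
      c • alphaFun dh x y u (iteratedDeriv k ξ) r
        + alphaFun dh x y u (iteratedDeriv (k + 1) ξ) r := fun k =>
    funext fun r => (hasDerivAt_alphaFun dh x y u (hd k) r).deriv
  have hα1 : iteratedDeriv 1 (alphaFun dh x y u ξ) = fun r =>
      c • alphaFun dh x y u (iteratedDeriv 0 ξ) r
        + alphaFun dh x y u (iteratedDeriv 1 ξ) r := by
    rw [iteratedDeriv_one]
    simpa only [iteratedDeriv_zero] using hα 0
  have hα2 : iteratedDeriv 2 (alphaFun dh x y u ξ) s =
      (c ^ 2) • alphaFun dh x y u (iteratedDeriv 0 ξ) s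
        + (2 * c) • alphaFun dh x y u (iteratedDeriv 1 ξ) s
        + alphaFun dh x y u (iteratedDeriv 2 ξ) s := by
    rw [iteratedDeriv_succ, hα1]
    refine (((hasDerivAt_alphaFun dh x y u (hd 0) s).const_smul c).add
      (hasDerivAt_alphaFun dh x y u (hd 1) s)).deriv.trans ?_
    rw [← hc]
    module
  have hTT : T ^ 2 ≤ C * T := by nlinarith
  interval_cases j
  · rw [iteratedDeriv_zero]
    refine (main 0 (by norm_num)).trans ?_
    gcongr
    exact le_add_of_nonneg_right (by positivity)
  · have h : iteratedDeriv 1 (alphaFun dh x y u ξ) s - iteratedDeriv 1 ξ s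
        = c • alphaFun dh x y u (iteratedDeriv 0 ξ) s
        + (alphaFun dh x y u (iteratedDeriv 1 ξ) s - iteratedDeriv 1 ξ s) := by
      rw [hα1]
      exact add_sub_assoc _ _ _
    calc _ ≤ ‖c‖ * ‖alphaFun dh x y u (iteratedDeriv 0 ξ) s‖
          + ‖alphaFun dh x y u (iteratedDeriv 1 ξ) s - iteratedDeriv 1 ξ s‖ := by
          rw [h, ← norm_smul]
          exact norm_add_le _ _
      _ ≤ (2 * Real.pi * T) * (N / (1 + s ^ 2)) + L * T / (1 + s ^ 2) := by
          gcongr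
          · exact hN1 0 (by norm_num)
          · exact main 1 (by norm_num)
      _ = (L + (2 * Real.pi) * N) * T / (1 + s ^ 2) := by ring
      _ ≤ _ := by
          gcongr
          nlinarith [Real.pi_pos, mul_pos (pow_pos Real.pi_pos 2) hC]
  · have h : iteratedDeriv 2 (alphaFun dh x y u ξ) s - iteratedDeriv 2 ξ s
        = (c ^ 2) • alphaFun dh x y u (iteratedDeriv 0 ξ) s
        + (2 * c) • alphaFun dh x y u (iteratedDeriv 1 ξ) s
        + (alphaFun dh x y u (iteratedDeriv 2 ξ) s - iteratedDeriv 2 ξ s) := by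
      rw [hα2]
      exact add_sub_assoc _ _ _
    calc _ ≤ ‖c‖ ^ 2 * ‖alphaFun dh x y u (iteratedDeriv 0 ξ) s‖
          + 2 * ‖c‖ * ‖alphaFun dh x y u (iteratedDeriv 1 ξ) s‖
          + ‖alphaFun dh x y u (iteratedDeriv 2 ξ) s - iteratedDeriv 2 ξ s‖ := by
          rw [h]
          refine norm_add₃_le.trans_eq ?_
          simp [norm_smul]
      _ ≤ (2 * Real.pi * T) ^ 2 * (N / (1 + s ^ 2))
          + 2 * (2 * Real.pi * T) * (N / (1 + s ^ 2)) + L * T / (1 + s ^ 2) := by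
          gcongr
          · exact hN1 0 (by norm_num)
          · exact hN1 1 (by norm_num)
          · exact main 2 (by norm_num)
      _ = 4 * Real.pi ^ 2 * T ^ 2 * (N / (1 + s ^ 2))
          + 4 * Real.pi * T * (N / (1 + s ^ 2)) + L * T / (1 + s ^ 2) := by ring
      _ ≤ 4 * Real.pi ^ 2 * (C * T) * (N / (1 + s ^ 2))
          + 4 * Real.pi * T * (N / (1 + s ^ 2)) + L * T / (1 + s ^ 2) := by gcongr
      _ = _ := by ring


end
end

section
/- Let E be a complex Banach space and 𝔥 a nonzero finite-dimensional real normed vector space. Suppose U assigns to each X ∈ 𝔥 a linear isometry U(X) of E onto itself such that U((s+t)X) = U(sX) ∘ U(tX) for all s, t ∈ ℝ and X ∈ 𝔥 (in particular U(0) is the identity), and such that for each X ∈ 𝔥 and η ∈ E the map t ∈ ℝ ↦ U(tX)η is continuous. Let ξ ∈ E be such that for every X ∈ 𝔥 the limit ∇_X ξ = lim_{t→0} (U(tX)ξ − ξ)/t exists in E, and assume that X ↦ ∇_X ξ is a linear map ∇ξ : 𝔥 → E. Then for every δ > 0: ‖∇ξ‖_op = sup{ ‖U(X)ξ − ξ‖_E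 / ‖X‖ : X ∈ 𝔥 ∖ {0} } = sup{ ‖U(X)ξ − ξ‖_E / ‖X‖ : X ∈ 𝔥, 0 < ‖X‖ ≤ δ } = limsup_{X→0} ‖U(X)ξ − ξ‖_E / ‖X‖. -/
open Filter Topology

/-- The orbit of a vector differentiable at `0` under a one-parameter group of isometries is
Lipschitz, with constant the norm of the derivative at `0`. -/
theorem norm_orbit_sub_le {E : Type*} [NormedAddCommGroup E] [NormedSpace ℂ E]
    {V : ℝ → (E ≃ₗᵢ[ℂ] E)} (hV : ∀ s t η, V (s + t) η = V s (V t η)) {ξ v : E}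
    (hv : Tendsto (fun t : ℝ => t⁻¹ • (V t ξ - ξ)) (𝓝[≠] 0) (𝓝 v)) (t : ℝ) :
    ‖V t ξ - ξ‖ ≤ ‖v‖ * ‖t‖ := by
  have h0 : V 0 ξ = ξ := (V 0).injective (by rw [← hV, add_zero])
  have hderiv (s : ℝ) : HasDerivAt (fun r => V r ξ) (V s v) s := by
    rw [hasDerivAt_iff_tendsto_slope_zero]
    refine (((V s).continuous.tendsto v).comp hv).congr fun r => ?_
    simp [hV, map_real_smul (V s) (V s).continuous]
  simpa [h0] using Convex.norm_image_sub_le_of_norm_hasDerivWithin_le (s := Set.univ)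
    (x := 0) (y := t) (fun s _ => (hderiv s).hasDerivWithinAt)
    (fun s _ => ((V s).norm_map v).le) convex_univ (Set.mem_univ _) (Set.mem_univ _)

/-- The supremum of the difference quotients of an orbit map over any punctured neighbourhood
of `0` is the operator norm of the derivative. -/
theorem isLUB_norm_orbit_sub_div {E H : Type*} [NormedAddCommGroup E] [NormedSpace ℂ E]
    [NormedAddCommGroup H] [NormedSpace ℝ H]
    {U : H → (E ≃ₗᵢ[ℂ] E)}
    (hgroup : ∀ (s t : ℝ) (X : H) (η : E), U ((s + t) • X) η = U (s • X) (U (t • X) η))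
    {ξ : E} {D : H →L[ℝ] E}
    (hD : ∀ X : H,
      Tendsto (fun t : ℝ => t⁻¹ • (U (t • X) ξ - ξ)) (𝓝[≠] (0 : ℝ)) (𝓝 (D X)))
    [Nontrivial H] {s : Set H} (hs : s ∈ 𝓝 0) :
    IsLUB {r : ℝ | ∃ X : H, X ≠ 0 ∧ X ∈ s ∧ r = ‖U X ξ - ξ‖ / ‖X‖} ‖D‖ := by
  have hsmall (X : H) (hX : X ≠ 0) : ∀ᶠ t : ℝ in 𝓝[≠] 0, t • X ≠ 0 ∧ t • X ∈ s := by
    have hmem : ∀ᶠ t : ℝ in 𝓝 0, t • X ∈ s :=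
      (show Continuous fun t : ℝ => t • X by fun_prop).tendsto' 0 0 (zero_smul ℝ X) hs
    filter_upwards [self_mem_nhdsWithin, nhdsWithin_le_nhds hmem] with t ht hts
    exact ⟨smul_ne_zero ht hX, hts⟩
  refine ⟨?_, fun C hC => ?_⟩
  · rintro r ⟨X, hX, -, rfl⟩
    rw [div_le_iff₀ (norm_pos_iff.2 hX)]
    have h := norm_orbit_sub_le (V := fun t => U (t • X)) (fun s t => hgroup s t X) (hD X) 1
    simp only [one_smul, norm_one, mul_one] at h
    exact h.trans (D.le_opNorm X)
  · have hC' (X : H) (hX : X ≠ 0) (hXs : X ∈ s) : ‖U X ξ - ξ‖ / ‖X‖ ≤ C := hC ⟨X, hX, hXs, rfl⟩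
    have hC0 : 0 ≤ C := by
      obtain ⟨X, hX⟩ := exists_ne (0 : H)
      obtain ⟨t, ht0, hts⟩ := (hsmall X hX).exists
      exact le_trans (by positivity) (hC' _ ht0 hts)
    refine D.opNorm_le_bound hC0 fun X => ?_
    rcases eq_or_ne X 0 with rfl | hX
    · simp
    refine le_of_tendsto (hD X).norm ?_
    filter_upwards [hsmall X hX, self_mem_nhdsWithin] with t ⟨ht0, hts⟩ ht
    have h := hC' _ ht0 hts
    rw [div_le_iff₀ (norm_pos_iff.2 ht0), norm_smul] at h
    rw [norm_smul, norm_inv, inv_mul_le_iff₀ (norm_pos_iff.2 ht)]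
    linarith

theorem statement_12 {E H : Type*} [NormedAddCommGroup E] [NormedSpace ℂ E] [CompleteSpace E]
    [NormedAddCommGroup H] [NormedSpace ℝ H] [FiniteDimensional ℝ H] [Nontrivial H]
    (U : H → (E ≃ₗᵢ[ℂ] E))
    (hgroup : ∀ (s t : ℝ) (X : H) (η : E), U ((s + t) • X) η = U (s • X) (U (t • X) η))
    (hcont : ∀ (X : H) (η : E), Continuous fun t : ℝ => U (t • X) η)
    (ξ : E) (D : H →L[ℝ] E)
    (hD : ∀ X : H,
      Tendsto (fun t : ℝ => (t : ℝ)⁻¹ • (U (t • X) ξ - ξ)) (𝓝[≠] (0 : ℝ)) (𝓝 (D X))) :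
    ∀ δ > (0 : ℝ),
      ‖D‖ = sSup { r : ℝ | ∃ X : H, X ≠ 0 ∧ r = ‖U X ξ - ξ‖ / ‖X‖ } ∧
      ‖D‖ = sSup { r : ℝ | ∃ X : H, X ≠ 0 ∧ ‖X‖ ≤ δ ∧ r = ‖U X ξ - ξ‖ / ‖X‖ } ∧
      ‖D‖ = ⨅ δ' : { d : ℝ // 0 < d },
              sSup { r : ℝ | ∃ X : H, X ≠ 0 ∧ ‖X‖ ≤ δ'.1 ∧ r = ‖U X ξ - ξ‖ / ‖X‖ } := by
  have hsup (s : Set H) (hs : s ∈ 𝓝 0) :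
      ‖D‖ = sSup {r : ℝ | ∃ X : H, X ≠ 0 ∧ X ∈ s ∧ r = ‖U X ξ - ξ‖ / ‖X‖} :=
    have h := isLUB_norm_orbit_sub_div hgroup hD hs
    (h.csSup_eq h.nonempty).symm
  have hball (d : ℝ) (hd : 0 < d) :
      ‖D‖ = sSup {r : ℝ | ∃ X : H, X ≠ 0 ∧ ‖X‖ ≤ d ∧ r = ‖U X ξ - ξ‖ / ‖X‖} := by
    simpa using hsup _ (Metric.closedBall_mem_nhds 0 hd)
  intro δ hδ
  have : Nonempty {d : ℝ // 0 < d} := ⟨δ, hδ⟩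
  refine ⟨by simpa using hsup _ univ_mem, hball δ hδ, ?_⟩
  rw [iInf_congr fun d : {d : ℝ // 0 < d} => (hball d.1 d.2).symm, ciInf_const]
end
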